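/- The moments m_n(t) of the free additive convolution μ_{sc,2√t} ⊞ Unif_{[-t,0]} satisfy the recursion d/dt m_n(t) = n*(t^{-1} m_n(t) - (1/2) ∑_{j=0}^{n-2} m_j(t) m_{n-j-2}(t)) for t > 0, m_n is a polynomial in t of degree n, and its leading coefficient is (-1)^n/(n+1). -/

import Mathlib

open MeasureTheory

/-- Signed Stirling numbers of the first kind. -/
def stirlingS1 : ℕ → ℕ → ℤ
  | 0, 0 => 1
  | 0, _ + 1 => 0
  | _ + 1, 0 => 0
  | n + 1, k + 1 => stirlingS1 n k - n * stirlingS1 n (k + 1)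

/-- The `n`-th moment of a measure on `ℝ`. -/
noncomputable def moment (μ : Measure ℝ) (n : ℕ) : ℝ := ∫ x, x ^ n ∂μ

/-- The free cumulants of a measure on `ℝ`, defined recursively through the
moment–cumulant relation `mₙ = ∑_{s=1}^n κ_s ∑_{i₁+⋯+i_s = n-s} m_{i₁} ⋯ m_{i_s}`,
which for measures with all moments finite is equivalent to the usual definition via
sums over non-crossing partitions. -/
noncomputable def freeCumulant (μ : Measure ℝ) : ℕ → ℝ
  | 0 => 0
  | n + 1 =>
    moment μ (n + 1) -
      ∑ s ∈ (Finset.range n).attach,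
        freeCumulant μ (s.1 + 1) *
          ∑ p ∈ Finset.Nat.antidiagonalTuple (s.1 + 1) (n - s.1),
            ∏ j, moment μ (p j)
  decreasing_by
    have := s.2
    simp only [Finset.mem_range] at this
    omega

/-- `IsFreeAdd μ ν ρ` asserts that `ρ` is the free additive convolution `μ ⊞ ν`,
characterized by additivity of free cumulants. -/
def IsFreeAdd (μ ν ρ : Measure ℝ) : Prop :=
  ∀ n : ℕ, freeCumulant ρ n = freeCumulant μ n + freeCumulant ν n

/-- The semicircle distribution of radius `R`. -/
noncomputable def semicircle (R : ℝ) : Measure ℝ :=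
  (volume.restrict (Set.Icc (-R) R)).withDensity fun x =>
    ENNReal.ofReal (2 / (Real.pi * R ^ 2) * Real.sqrt (R ^ 2 - x ^ 2))

/-- The uniform distribution on `[a, b]`. -/
noncomputable def unif (a b : ℝ) : Measure ℝ :=
  (ENNReal.ofReal (b - a))⁻¹ • volume.restrict (Set.Icc a b)

theorem PowerSeries.coeff_mk_pow_eq_sum_antidiagonalTuple {R : Type*} [CommRing R] (m : ℕ → R)
    (k d : ℕ) :
    PowerSeries.coeff d (PowerSeries.mk m ^ k) =
      ∑ p ∈ Finset.Nat.antidiagonalTuple k d, ∏ j, m (p j) := by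
  have h := PowerSeries.coeff_prod (fun _ : Fin k => PowerSeries.mk m) d Finset.univ
  rw [Finset.prod_const, Finset.card_univ, Fintype.card_fin] at h
  rw [h]
  refine Finset.sum_nbij' (fun l => (l : Fin k → ℕ)) (fun p => Finsupp.equivFunOnFinite.symm p)
    ?_ ?_ ?_ ?_ ?_
  · intro l hl
    rw [Finset.mem_finsuppAntidiag] at hl
    exact Finset.Nat.mem_antidiagonalTuple.2 hl.1
  · intro p hp
    rw [Finset.mem_finsuppAntidiag]
    exact ⟨Finset.Nat.mem_antidiagonalTuple.1 hp, Finset.subset_univ _⟩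
  · intro l _
    ext; rfl
  · intro p _
    rfl
  · intro l _
    simp

theorem PowerSeries.coeff_pow_congr {R : Type*} [CommRing R] {f g : PowerSeries R} {n : ℕ}
    (h : ∀ i ≤ n, PowerSeries.coeff i f = PowerSeries.coeff i g) (k : ℕ) :
    ∀ i ≤ n, PowerSeries.coeff i (f ^ k) = PowerSeries.coeff i (g ^ k) := by
  have hd : (PowerSeries.X : PowerSeries R) ^ (n + 1) ∣ f ^ k - g ^ k := by
    refine dvd_trans ?_ (sub_dvd_pow_sub_pow f g k)
    rw [PowerSeries.X_pow_dvd_iff]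
    intro i hi
    rw [map_sub, h i (by omega), sub_self]
  intro i hi
  have := PowerSeries.X_pow_dvd_iff.1 hd i (by omega)
  rwa [map_sub, sub_eq_zero] at this

/-- The sequences `c` of free cumulants and `m` of moments (in a commutative ring) satisfy the
free moment-cumulant relation. -/
structure IsMomentCumulant {R : Type*} [CommRing R] (c m : ℕ → R) : Prop where
  zero : m 0 = 1
  succ : ∀ n, m (n + 1) = ∑ s ∈ Finset.range (n + 1),
    c (s + 1) * PowerSeries.coeff (n - s) (PowerSeries.mk m ^ (s + 1))

/-- The moments attached to a sequence of free cumulants. -/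
noncomputable def momentOfCumulant {R : Type*} [CommRing R] (c : ℕ → R) : ℕ → R
  | 0 => 1
  | n + 1 => ∑ s ∈ Finset.range (n + 1), c (s + 1) *
      PowerSeries.coeff (n - s)
        (PowerSeries.mk (fun i => if _ : i ≤ n then momentOfCumulant c i else 0) ^ (s + 1))

theorem isMomentCumulant_momentOfCumulant {R : Type*} [CommRing R] (c : ℕ → R) :
    IsMomentCumulant c (momentOfCumulant c) := by
  refine ⟨by rw [momentOfCumulant], fun n => ?_⟩
  rw [momentOfCumulant]
  refine Finset.sum_congr rfl fun s _ => ?_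
  congr 1
  refine PowerSeries.coeff_pow_congr (n := n) (fun i hi => ?_) _ _ (Nat.sub_le _ _)
  simp [hi]

namespace IsMomentCumulant

variable {R S : Type*} [CommRing R] [CommRing S] {c c' m m' : ℕ → R}

theorem moment_unique (h : IsMomentCumulant c m) (h' : IsMomentCumulant c' m')
    (hc : ∀ n, c (n + 1) = c' (n + 1)) (n : ℕ) : m n = m' n := by
  induction n using Nat.strong_induction_on with
  | _ n ih =>
    cases n with
    | zero => rw [h.zero, h'.zero]
    | succ n =>
      rw [h.succ, h'.succ]
      refine Finset.sum_congr rfl fun s _ => ?_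
      rw [hc]
      congr 1
      refine PowerSeries.coeff_pow_congr (n := n) (fun i hi => ?_) _ _ (Nat.sub_le _ _)
      simpa using ih i (by omega)

theorem cumulant_unique (h : IsMomentCumulant c m) (h' : IsMomentCumulant c' m')
    (hm : ∀ n, m n = m' n) (n : ℕ) : c (n + 1) = c' (n + 1) := by
  obtain rfl : m = m' := funext hm
  induction n using Nat.strong_induction_on with
  | _ n ih =>
    have e := (h.succ n).symm.trans (h'.succ n)
    rw [Finset.sum_range_succ, Finset.sum_range_succ, Finset.sum_congr rfl fun s hs => by
      rw [ih s (Finset.mem_range.1 hs)]] at e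
    simpa [h.zero] using e

theorem map (h : IsMomentCumulant c m) (φ : R →+* S) :
    IsMomentCumulant (fun n => φ (c n)) (fun n => φ (m n)) := by
  refine ⟨by simp [h.zero], fun n => ?_⟩
  have e : PowerSeries.mk (fun n => φ (m n)) = PowerSeries.map φ (PowerSeries.mk m) := by
    ext; simp
  rw [h.succ, map_sum, e]
  refine Finset.sum_congr rfl fun s _ => ?_
  rw [← _root_.map_pow, PowerSeries.coeff_map, map_mul]

theorem scale (h : IsMomentCumulant c m) (r : R) :
    IsMomentCumulant (fun n => r ^ n * c n) (fun n => r ^ n * m n) := by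
  refine ⟨by simp [h.zero], fun n => ?_⟩
  have e : PowerSeries.mk (fun n => r ^ n * m n) = PowerSeries.rescale r (PowerSeries.mk m) := by
    ext; simp [PowerSeries.coeff_rescale]
  rw [h.succ, e, Finset.mul_sum]
  refine Finset.sum_congr rfl fun s hs => ?_
  rw [← _root_.map_pow, PowerSeries.coeff_rescale]
  have : n + 1 = (s + 1) + (n - s) := by have := Finset.mem_range.1 hs; omega
  rw [this, pow_add]
  ring

/-- The functional equation `M(z) = C(z M(z))` modulo `z ^ N`. -/
theorem X_pow_dvd_sub (h : IsMomentCumulant c m) (N : ℕ) :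
    (PowerSeries.X : PowerSeries R) ^ N ∣ PowerSeries.mk m -
      (1 + ∑ s ∈ Finset.range N,
        PowerSeries.C (c (s + 1)) * (PowerSeries.X * PowerSeries.mk m) ^ (s + 1)) := by
  rw [PowerSeries.X_pow_dvd_iff]
  intro n hn
  rw [map_sub, sub_eq_zero, map_add, map_sum, PowerSeries.coeff_mk]
  simp only [PowerSeries.coeff_C_mul, mul_pow, PowerSeries.coeff_X_pow_mul']
  cases n with
  | zero => simp [h.zero]
  | succ n =>
    rw [h.succ, PowerSeries.coeff_one, if_neg n.succ_ne_zero, zero_add]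
    obtain ⟨k, rfl⟩ := Nat.exists_eq_add_of_le hn.le
    rw [Finset.sum_range_add _ (n + 1) k, Finset.sum_eq_zero (s := Finset.range k), add_zero]
    · refine Finset.sum_congr rfl fun s hs => ?_
      have := Finset.mem_range.1 hs
      rw [if_pos (by omega), Nat.add_sub_add_right]
    · intro s _
      rw [if_neg (by omega), mul_zero]

end IsMomentCumulant

/-- Apply a derivation of the coefficient ring to every coefficient of a power series. -/
noncomputable def PowerSeries.coeffDerivation {A R : Type*} [CommRing A] [CommRing R] [Algebra A R]
    (d : Derivation A R R) : Derivation A (PowerSeries R) (PowerSeries R) :=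
  Derivation.mk'
    { toFun := fun f => PowerSeries.mk fun n => d (PowerSeries.coeff n f)
      map_add' := fun f g => by ext; simp
      map_smul' := fun a f => by ext; simp }
    (fun f g => by
      ext n
      simp only [LinearMap.coe_mk, AddHom.coe_mk, PowerSeries.coeff_mk, smul_eq_mul, map_add,
        PowerSeries.coeff_mul, map_sum, Derivation.leibniz, Finset.sum_add_distrib]
      congr 1
      rw [← Finset.Nat.sum_antidiagonal_swap]
      rfl)

@[simp]
theorem PowerSeries.coeff_coeffDerivation {A R : Type*} [CommRing A] [CommRing R] [Algebra A R]
    (d : Derivation A R R) (f : PowerSeries R) (n : ℕ) :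
    PowerSeries.coeff n (PowerSeries.coeffDerivation d f) = d (PowerSeries.coeff n f) :=
  PowerSeries.coeff_mk n fun k => d (PowerSeries.coeff k f)

@[simp]
theorem PowerSeries.coeffDerivation_C {A R : Type*} [CommRing A] [CommRing R] [Algebra A R]
    (d : Derivation A R R) (r : R) :
    PowerSeries.coeffDerivation d (PowerSeries.C r) = PowerSeries.C (d r) := by
  ext n
  simp only [coeff_coeffDerivation, PowerSeries.coeff_C]
  split_ifs <;> simp

@[simp]
theorem PowerSeries.coeffDerivation_X {A R : Type*} [CommRing A] [CommRing R] [Algebra A R]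
    (d : Derivation A R R) :
    PowerSeries.coeffDerivation d (PowerSeries.X : PowerSeries R) = 0 := by
  ext n
  simp only [coeff_coeffDerivation, PowerSeries.coeff_X]
  split_ifs <;> simp

open PowerSeries in
/-- If a derivation of the coefficients kills all the free cumulants but the second, where it
takes the value `1`, then the moment series satisfies the complex Burgers equation. -/
theorem IsMomentCumulant.coeffDerivation_eq {A R : Type*} [CommRing A] [CommRing R] [Algebra A R]
    {c m : ℕ → R} (h : IsMomentCumulant c m) (d : Derivation A R R)
    (hd : ∀ n, d (c n) = if n = 2 then 1 else 0) :
    coeffDerivation d (PowerSeries.mk m) =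
      X * ((X * PowerSeries.mk m) * d⁄dX R (X * PowerSeries.mk m)) := by
  rw [← sub_eq_zero]
  ext n
  rw [map_zero]
  obtain ⟨E, hE⟩ := h.X_pow_dvd_sub (n + 2)
  set M := PowerSeries.mk m
  set W := X * M with hW
  set P : R⟦X⟧ :=
    ∑ s ∈ Finset.range (n + 2), C (c (s + 1)) * (((s + 1 : ℕ) : R⟦X⟧) * W ^ s)
  have hM : M = 1 + ∑ s ∈ Finset.range (n + 2), C (c (s + 1)) * W ^ (s + 1) + X ^ (n + 2) * E := by
    rw [← hE]; ring
  have h1 : coeffDerivation d M = W ^ 2 + P * (X * coeffDerivation d M) +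
      X ^ (n + 2) * coeffDerivation d E := by
    have hw : coeffDerivation d W = X * coeffDerivation d M := by
      rw [hW, Derivation.leibniz, coeffDerivation_X, smul_zero, add_zero, smul_eq_mul]
    rw [← hw]
    conv_lhs => rw [hM]
    simp only [map_add, map_sum, Derivation.leibniz, Derivation.leibniz_pow, coeffDerivation_C,
      coeffDerivation_X, hd, smul_eq_mul, nsmul_eq_mul, Derivation.map_one_eq_zero,
      Finset.sum_add_distrib, mul_zero, smul_zero, zero_add, add_zero]
    have : ∑ s ∈ Finset.range (n + 2), W ^ (s + 1) * C (if s + 1 = 2 then (1 : R) else 0) =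
        W ^ 2 := by
      rw [Finset.sum_eq_single 1]
      · simp
      · intro b _ hb
        rw [if_neg (by omega), map_zero, mul_zero]
      · simp
    rw [this, Finset.sum_mul, add_comm (W ^ 2)]
    congr 2
    refine Finset.sum_congr rfl fun s _ => ?_
    rw [Nat.add_sub_cancel]
    ring
  have hw : d⁄dX R W = M + X * d⁄dX R M := by
    rw [hW, Derivation.leibniz, derivative_X, smul_eq_mul, smul_eq_mul]
    ring
  have h2 : ∃ E', d⁄dX R M = P * (M + X * d⁄dX R M) + X ^ (n + 1) * E' := by
    refine ⟨((n + 2 : ℕ) : R⟦X⟧) * E + X * d⁄dX R E, ?_⟩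
    rw [← hw]
    conv_lhs => rw [hM]
    simp only [map_add, map_sum, Derivation.leibniz, Derivation.leibniz_pow, derivative_C,
      derivative_X, smul_eq_mul, nsmul_eq_mul, Derivation.map_one_eq_zero,
      mul_zero, zero_add, add_zero]
    rw [Finset.sum_mul]
    congr 1
    · refine Finset.sum_congr rfl fun s _ => ?_
      rw [Nat.add_sub_cancel]
      ring
    · rw [show n + 2 - 1 = n + 1 by omega]
      ring
  obtain ⟨E', h2⟩ := h2
  have key : (1 - X * P) * (coeffDerivation d M - X * (W * d⁄dX R W)) =
      X ^ (n + 1) * (X * coeffDerivation d E - X * W * X * E') := by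
    rw [hw]
    linear_combination h1 - X * W * X * h2
  have hu : IsUnit (1 - X * P) := by
    rw [PowerSeries.isUnit_iff_constantCoeff]
    simp
  have hdvd : X ^ (n + 1) ∣ coeffDerivation d M - X * (W * d⁄dX R W) :=
    hu.dvd_mul_left.1 ⟨_, key⟩
  exact PowerSeries.X_pow_dvd_iff.1 hdvd n (Nat.lt_succ_self n)

open PowerSeries in
theorem IsMomentCumulant.two_mul_derivation_eq {A R : Type*} [CommRing A] [CommRing R]
    [Algebra A R] {c m : ℕ → R} (h : IsMomentCumulant c m) (d : Derivation A R R)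
    (hd : ∀ n, d (c n) = if n = 2 then 1 else 0) (n : ℕ) :
    2 * d (m n) = n * ∑ j ∈ Finset.range (n - 1), m j * m (n - j - 2) := by
  have e := congrArg (coeff n) (congrArg (2 * ·) (h.coeffDerivation_eq d hd))
  have e2 : 2 * (X * ((X * PowerSeries.mk m) * d⁄dX R (X * PowerSeries.mk m))) =
      X * d⁄dX R (X ^ 2 * (PowerSeries.mk m * PowerSeries.mk m)) := by
    rw [show X ^ 2 * (PowerSeries.mk m * PowerSeries.mk m) = (X * PowerSeries.mk m) ^ 2 by ring,
      PowerSeries.derivative_pow]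
    push_cast
    ring
  simp only [e2] at e
  rw [← map_ofNat (C (R := R)) 2, coeff_C_mul, coeff_coeffDerivation, coeff_mk] at e
  rw [e]
  cases n with
  | zero => simp
  | succ n =>
    rw [coeff_succ_X_mul, coeff_derivative, coeff_X_pow_mul', mul_comm]
    push_cast
    congr 1
    cases n with
    | zero => simp
    | succ k =>
      rw [if_pos (by omega), coeff_mul, Finset.Nat.sum_antidiagonal_eq_sum_range_succ
        (fun i j => coeff i (PowerSeries.mk m) * coeff j (PowerSeries.mk m))]
      refine Finset.sum_congr (by simp) fun j _ => ?_
      rw [coeff_mk, coeff_mk]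
      congr 2
      omega

theorem moment_zero_eq_one (μ : Measure ℝ) [IsProbabilityMeasure μ] :
    moment μ 0 = 1 := by
  simp [moment]

theorem isMomentCumulant_freeCumulant {μ : Measure ℝ} (h : moment μ 0 = 1) :
    IsMomentCumulant (freeCumulant μ) (moment μ) := by
  refine ⟨h, fun n => ?_⟩
  rw [Finset.sum_range_succ, freeCumulant, Finset.sum_attach (Finset.range n) fun s =>
    freeCumulant μ (s + 1) * ∑ p ∈ Finset.Nat.antidiagonalTuple (s + 1) (n - s),
      ∏ j, moment μ (p j)]
  simp only [PowerSeries.coeff_mk_pow_eq_sum_antidiagonalTuple, Nat.sub_self,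
    Finset.Nat.antidiagonalTuple_zero_right, Finset.sum_singleton, Pi.zero_apply, h,
    Finset.prod_const_one, mul_one]
  ring

theorem moment_unif {a b : ℝ} (hab : a < b) (n : ℕ) :
    moment (unif a b) n = (b - a)⁻¹ * ((b ^ (n + 1) - a ^ (n + 1)) / (n + 1)) := by
  rw [moment, unif, integral_smul_measure, integral_Icc_eq_integral_Ioc,
    ← intervalIntegral.integral_of_le hab.le, integral_pow, ENNReal.toReal_inv,
    ENNReal.toReal_ofReal (sub_nonneg.2 hab.le), smul_eq_mul]

theorem moment_unif_neg_zero {t : ℝ} (ht : 0 < t) (n : ℕ) :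
    moment (unif (-t) 0) n = (-t) ^ n / (n + 1) := by
  rw [moment_unif (neg_lt_zero.2 ht), zero_pow n.succ_ne_zero, pow_succ, zero_sub, zero_sub,
    neg_neg]
  field_simp

theorem freeCumulant_unif_neg_zero {t : ℝ} (ht : 0 < t) (n : ℕ) :
    freeCumulant (unif (-t) 0) n = t ^ n * freeCumulant (unif (-1) 0) n := by
  cases n with
  | zero => simp [freeCumulant]
  | succ n =>
    refine (isMomentCumulant_freeCumulant ?_).cumulant_unique
      ((isMomentCumulant_freeCumulant ?_).scale t) (fun k => ?_) n
    · simp [moment_unif_neg_zero ht]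
    · simp [moment_unif_neg_zero one_pos]
    · rw [moment_unif_neg_zero ht, moment_unif_neg_zero one_pos, neg_pow t, neg_pow 1]
      ring

theorem moment_semicircle {R : ℝ} (hR : 0 < R) (n : ℕ) :
    moment (semicircle R) n =
      2 / (Real.pi * R ^ 2) * ∫ x in (-R)..R, x ^ n * √(R ^ 2 - x ^ 2) := by
  rw [moment, semicircle, integral_withDensity_eq_integral_toReal_smul (by fun_prop)
    (by simp), integral_Icc_eq_integral_Ioc, ← intervalIntegral.integral_of_le (by linarith),
    ← intervalIntegral.integral_const_mul]
  refine intervalIntegral.integral_congr fun x _ => ?_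
  simp only [smul_eq_mul]
  rw [ENNReal.toReal_ofReal (by positivity)]
  ring

theorem hasDerivAt_sq_sub_sq_mul_sqrt {R x : ℝ} (hx : x ∈ Set.Ioo (-R) R) :
    HasDerivAt (fun x : ℝ => (R ^ 2 - x ^ 2) * √(R ^ 2 - x ^ 2))
      (-3 * x * √(R ^ 2 - x ^ 2)) x := by
  have hpos : 0 < R ^ 2 - x ^ 2 := by nlinarith [hx.1, hx.2]
  have h1 : HasDerivAt (fun x : ℝ => R ^ 2 - x ^ 2) (-(2 * x)) x := by
    simpa using (hasDerivAt_pow 2 x).const_sub (R ^ 2)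
  convert! h1.mul (h1.sqrt hpos.ne') using 1
  have hs : √(R ^ 2 - x ^ 2) ≠ 0 := (Real.sqrt_pos.2 hpos).ne'
  have hsq : √(R ^ 2 - x ^ 2) ^ 2 = R ^ 2 - x ^ 2 := Real.sq_sqrt hpos.le
  field_simp
  rw [hsq]
  ring

theorem integral_mul_sqrt_sq_sub_sq {R : ℝ} (hR : 0 < R) :
    ∫ x in (-R)..R, x * √(R ^ 2 - x ^ 2) = 0 := by
  have h := intervalIntegral.integral_eq_sub_of_hasDerivAt_of_le (by linarith : -R ≤ R)
    (f := fun x : ℝ => (R ^ 2 - x ^ 2) * √(R ^ 2 - x ^ 2))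
    (f' := fun x => -3 * x * √(R ^ 2 - x ^ 2)) (by fun_prop)
    (fun x hx => hasDerivAt_sq_sub_sq_mul_sqrt hx)
    (Continuous.intervalIntegrable (by fun_prop) _ _)
  simp only [mul_assoc, intervalIntegral.integral_const_mul] at h
  simpa using h

theorem integral_pow_add_two_mul_sqrt_sq_sub_sq {R : ℝ} (hR : 0 < R) (n : ℕ) :
    ((n : ℝ) + 4) * ∫ x in (-R)..R, x ^ (n + 2) * √(R ^ 2 - x ^ 2) =
      (n + 1) * R ^ 2 * ∫ x in (-R)..R, x ^ n * √(R ^ 2 - x ^ 2) := by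
  have h := intervalIntegral.integral_eq_sub_of_hasDerivAt_of_le (by linarith : -R ≤ R)
    (f := fun x : ℝ => x ^ (n + 1) * ((R ^ 2 - x ^ 2) * √(R ^ 2 - x ^ 2)))
    (f' := fun x => (n + 1) * R ^ 2 * (x ^ n * √(R ^ 2 - x ^ 2)) -
      ((n : ℝ) + 4) * (x ^ (n + 2) * √(R ^ 2 - x ^ 2))) (by fun_prop)
    (fun x hx => by
      convert! (hasDerivAt_pow (n + 1) x).mul (hasDerivAt_sq_sub_sq_mul_sqrt hx) using 1
      push_cast
      ring)
    (Continuous.intervalIntegrable (by fun_prop) _ _)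
  rw [intervalIntegral.integral_sub (Continuous.intervalIntegrable (by fun_prop) _ _)
    (Continuous.intervalIntegrable (by fun_prop) _ _), intervalIntegral.integral_const_mul,
    intervalIntegral.integral_const_mul] at h
  simp only [neg_sq, sub_self, zero_mul, mul_zero] at h
  linarith

theorem integral_sqrt_sq_sub_sq {R : ℝ} (hR : 0 < R) :
    ∫ x in (-R)..R, √(R ^ 2 - x ^ 2) = Real.pi * R ^ 2 / 2 := by
  have h := intervalIntegral.mul_integral_comp_mul_left (a := -1) (b := 1)
    (f := fun x => √(R ^ 2 - x ^ 2)) R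
  rw [mul_neg_one, mul_one] at h
  rw [← h]
  have : ∀ x : ℝ, √(R ^ 2 - (R * x) ^ 2) = R * √(1 - x ^ 2) := fun x => by
    rw [show R ^ 2 - (R * x) ^ 2 = R ^ 2 * (1 - x ^ 2) by ring, Real.sqrt_mul (sq_nonneg R),
      Real.sqrt_sq hR.le]
  simp only [this, intervalIntegral.integral_const_mul, integral_sqrt_one_sub_sq]
  ring

theorem moment_semicircle_zero {R : ℝ} (hR : 0 < R) : moment (semicircle R) 0 = 1 := by
  rw [moment_semicircle hR]
  simp only [pow_zero, one_mul, integral_sqrt_sq_sub_sq hR]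
  have := Real.pi_pos
  field_simp

theorem moment_semicircle_one {R : ℝ} (hR : 0 < R) : moment (semicircle R) 1 = 0 := by
  rw [moment_semicircle hR]
  simp only [pow_one, integral_mul_sqrt_sq_sub_sq hR, mul_zero]

theorem moment_semicircle_add_two {R : ℝ} (hR : 0 < R) (n : ℕ) :
    ((n : ℝ) + 4) * moment (semicircle R) (n + 2) =
      (n + 1) * R ^ 2 * moment (semicircle R) n := by
  rw [moment_semicircle hR, moment_semicircle hR]
  linear_combination 2 / (Real.pi * R ^ 2) * integral_pow_add_two_mul_sqrt_sq_sub_sq hR n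

theorem add_two_mul_catalan_succ (k : ℕ) :
    (k + 2) * catalan (k + 1) = 2 * (2 * k + 1) * catalan k := by
  have h1 := succ_mul_catalan_eq_centralBinom (k + 1)
  have h2 := succ_mul_catalan_eq_centralBinom k
  have h3 := Nat.succ_mul_centralBinom_succ k
  refine Nat.eq_of_mul_eq_mul_left k.succ_pos ?_
  simp only [Nat.succ_eq_add_one] at *
  rw [← h1, ← h2] at h3
  linarith

/-- The moment series of the semicircle distribution of variance `t`. -/
noncomputable def semicircleSeries (t : ℝ) : PowerSeries ℝ :=
  PowerSeries.expand 2 two_ne_zero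
    (PowerSeries.rescale t (PowerSeries.map (Nat.castRingHom ℝ) PowerSeries.catalanSeries))

theorem mk_moment_semicircle {t : ℝ} (ht : 0 < t) :
    PowerSeries.mk (moment (semicircle (2 * √t))) = semicircleSeries t := by
  have hR : 0 < 2 * √t := by positivity
  have hR2 : (2 * √t) ^ 2 = 4 * t := by rw [mul_pow, Real.sq_sqrt ht.le]; ring
  have hev : ∀ k : ℕ, moment (semicircle (2 * √t)) (2 * k) = t ^ k * catalan k := by
    intro k
    induction k with
    | zero => simp [moment_semicircle_zero hR]
    | succ k ih =>
      have h := moment_semicircle_add_two hR (2 * k)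
      rw [ih, hR2] at h
      have hc : ((k : ℝ) + 2) * catalan (k + 1) = 2 * (2 * k + 1) * catalan k := by
        exact_mod_cast add_two_mul_catalan_succ k
      have h4 : ((2 * k : ℕ) : ℝ) + 4 ≠ 0 := by positivity
      refine mul_left_cancel₀ h4 ?_
      rw [show 2 * (k + 1) = 2 * k + 2 by ring, h]
      push_cast
      linear_combination -2 * t ^ (k + 1) * hc
  have hodd : ∀ k : ℕ, moment (semicircle (2 * √t)) (2 * k + 1) = 0 := by
    intro k
    induction k with
    | zero => simp [moment_semicircle_one hR]
    | succ k ih =>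
      have h := moment_semicircle_add_two hR (2 * k + 1)
      rw [ih, mul_zero] at h
      exact (mul_eq_zero.1 h).resolve_left (by positivity)
  ext n
  rw [PowerSeries.coeff_mk, semicircleSeries]
  obtain ⟨k, rfl | rfl⟩ := Nat.even_or_odd' n
  · rw [PowerSeries.coeff_expand_mul, hev, PowerSeries.coeff_rescale, PowerSeries.coeff_map,
      PowerSeries.catalanSeries_coeff]
    rfl
  · rw [PowerSeries.coeff_expand_of_not_dvd _ _ _ (by omega), hodd]

theorem semicircleSeries_eq (t : ℝ) :
    semicircleSeries t =
      PowerSeries.X ^ 2 * (PowerSeries.C t * semicircleSeries t ^ 2) + 1 := by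
  have h := congrArg (fun f => PowerSeries.expand 2 two_ne_zero
    (PowerSeries.rescale t (PowerSeries.map (Nat.castRingHom ℝ) f)))
    PowerSeries.catalanSeries_sq_mul_X_add_one
  simp only [map_add, map_mul, map_pow, map_one, PowerSeries.map_X, PowerSeries.rescale_X,
    PowerSeries.expand_X, PowerSeries.expand_C] at h
  change semicircleSeries t ^ 2 * _ + 1 = semicircleSeries t at h
  conv_lhs => rw [← h]
  ring

theorem isMomentCumulant_semicircle {t : ℝ} (ht : 0 < t) :
    IsMomentCumulant (fun n => if n = 2 then t else 0) (moment (semicircle (2 * √t))) := by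
  refine ⟨moment_semicircle_zero (by positivity), fun n => ?_⟩
  rw [← PowerSeries.coeff_mk (n + 1) (moment _), mk_moment_semicircle ht]
  conv_lhs => rw [semicircleSeries_eq]
  rw [map_add, PowerSeries.coeff_one, if_neg n.succ_ne_zero, add_zero,
    PowerSeries.coeff_X_pow_mul', PowerSeries.coeff_C_mul]
  cases n with
  | zero => simp
  | succ n =>
    rw [if_pos (by omega), Finset.sum_eq_single 1]
    · rfl
    · intro b _ hb
      rw [if_neg (by omega), zero_mul]
    · simp

theorem freeCumulant_semicircle {t : ℝ} (ht : 0 < t) (n : ℕ) :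
    freeCumulant (semicircle (2 * √t)) n = if n = 2 then t else 0 := by
  cases n with
  | zero => simp [freeCumulant]
  | succ n =>
    exact (isMomentCumulant_freeCumulant (moment_semicircle_zero (by positivity))).cumulant_unique
      (isMomentCumulant_semicircle ht) (fun _ => rfl) n

open Polynomial in
/-- The moments of the free convolution of `unif (-1) 0` with a semicircle distribution, as
polynomials in the variance of the latter. -/
noncomputable def freeBrownianMoment : ℕ → ℝ[X] :=
  momentOfCumulant fun n => C (freeCumulant (unif (-1) 0) n) + if n = 2 then X else 0

theorem isMomentCumulant_freeBrownianMoment :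
    IsMomentCumulant (fun n => Polynomial.C (freeCumulant (unif (-1) 0) n) +
      if n = 2 then Polynomial.X else 0) freeBrownianMoment :=
  isMomentCumulant_momentOfCumulant _

theorem two_mul_derivative_freeBrownianMoment (n : ℕ) :
    2 * (freeBrownianMoment n).derivative = n * ∑ j ∈ Finset.range (n - 1),
      freeBrownianMoment j * freeBrownianMoment (n - j - 2) := by
  refine isMomentCumulant_freeBrownianMoment.two_mul_derivation_eq
    (Polynomial.derivative' (R := ℝ)) (fun k => ?_) n
  change Polynomial.derivative _ = _
  split_ifs <;> simp

theorem natDegree_freeBrownianMoment_le (n : ℕ) : (freeBrownianMoment n).natDegree ≤ n := by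
  induction n using Nat.strong_induction_on with
  | _ n ih =>
    have h : (freeBrownianMoment n).derivative =
        Polynomial.C ((n : ℝ) / 2) * ∑ j ∈ Finset.range (n - 1),
          freeBrownianMoment j * freeBrownianMoment (n - j - 2) := by
      have h2 : (2 : Polynomial ℝ) = Polynomial.C 2 := rfl
      refine mul_left_cancel₀ (two_ne_zero (α := Polynomial ℝ)) ?_
      rw [two_mul_derivative_freeBrownianMoment, ← mul_assoc, h2, ← Polynomial.C_mul,
        mul_div_cancel₀ _ two_ne_zero, Polynomial.C_eq_natCast]
    have hd := congrArg Polynomial.natDegree h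
    rw [Polynomial.natDegree_derivative] at hd
    have hle : (Polynomial.C ((n : ℝ) / 2) * ∑ j ∈ Finset.range (n - 1),
          freeBrownianMoment j * freeBrownianMoment (n - j - 2)).natDegree ≤ n - 2 := by
      refine (Polynomial.natDegree_C_mul_le _ _).trans
        (Polynomial.natDegree_sum_le_of_forall_le _ _ fun j hj => ?_)
      have hj := Finset.mem_range.1 hj
      refine Polynomial.natDegree_mul_le.trans ?_
      have h1 := ih j (by omega)
      have h2 := ih (n - j - 2) (by omega)
      omega
    rcases Nat.eq_zero_or_pos n with rfl | hn
    · simp [isMomentCumulant_freeBrownianMoment.zero]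
    · omega

theorem eval_zero_freeBrownianMoment (n : ℕ) :
    (freeBrownianMoment n).eval 0 = (-1) ^ n / (n + 1) := by
  rw [← moment_unif_neg_zero one_pos]
  refine (isMomentCumulant_freeBrownianMoment.map (Polynomial.evalRingHom 0)).moment_unique
    (isMomentCumulant_freeCumulant (by simp [moment_unif_neg_zero one_pos])) (fun k => ?_) n
  simp only [Polynomial.coe_evalRingHom, Polynomial.eval_add, Polynomial.eval_C]
  split_ifs <;> simp

theorem moment_eq_pow_mul_eval {t : ℝ} (ht : 0 < t) {μ : Measure ℝ} [IsProbabilityMeasure μ]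
    (h : IsFreeAdd (semicircle (2 * √t)) (unif (-t) 0) μ) (n : ℕ) :
    moment μ n = t ^ n * (freeBrownianMoment n).eval t⁻¹ := by
  refine (isMomentCumulant_freeCumulant (moment_zero_eq_one μ)).moment_unique
    ((isMomentCumulant_freeBrownianMoment.map (Polynomial.evalRingHom t⁻¹)).scale t)
    (fun k => ?_) n
  rw [h, freeCumulant_semicircle ht, freeCumulant_unif_neg_zero ht]
  simp only [Polynomial.coe_evalRingHom, Polynomial.eval_add, Polynomial.eval_C]
  split_ifs with hk
  · rw [hk, Polynomial.eval_X]
    field_simp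
    ring
  · simp

theorem moment_polynomial_and_recursion_ODE (ρ : ℝ → Measure ℝ)
    (hρ : ∀ t : ℝ, 0 < t → IsProbabilityMeasure (ρ t) ∧
      IsFreeAdd (semicircle (2 * Real.sqrt t)) (unif (-t) 0) (ρ t)) (n : ℕ) :
    (∃ p : Polynomial ℝ, p.degree = (n : ℕ) ∧
      p.leadingCoeff = (-1 : ℝ) ^ n / ((n : ℝ) + 1) ∧
      ∀ t : ℝ, 0 < t → moment (ρ t) n = p.eval t) ∧
    (∀ t : ℝ, 0 < t →
      HasDerivAt (fun s : ℝ => moment (ρ s) n)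
        ((n : ℝ) * (t⁻¹ * moment (ρ t) n -
          (1 / 2) * ∑ j ∈ Finset.range (n - 1),
            moment (ρ t) j * moment (ρ t) (n - j - 2))) t) := by
  have hm : ∀ t : ℝ, 0 < t → ∀ k, moment (ρ t) k =
      t ^ k * (freeBrownianMoment k).eval t⁻¹ := fun t ht k => by
    obtain ⟨_, h⟩ := hρ t ht
    exact moment_eq_pow_mul_eval ht h k
  constructor
  · have hc : (Polynomial.reflect n (freeBrownianMoment n)).coeff n = (-1) ^ n / (n + 1) := by
      rw [Polynomial.coeff_reflect, Polynomial.revAt_le le_rfl, Nat.sub_self,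
        Polynomial.coeff_zero_eq_eval_zero, eval_zero_freeBrownianMoment]
    have hdeg : (Polynomial.reflect n (freeBrownianMoment n)).natDegree = n := by
      refine le_antisymm (Polynomial.natDegree_reflect_le.trans
        (max_le le_rfl (natDegree_freeBrownianMoment_le n)))
        (Polynomial.le_natDegree_of_ne_zero ?_)
      rw [hc]
      exact div_ne_zero (pow_ne_zero _ (by norm_num)) (by positivity)
    have hne : (Polynomial.reflect n (freeBrownianMoment n)) ≠ 0 := by
      rintro h0
      rw [h0, Polynomial.coeff_zero, eq_comm] at hc
      exact div_ne_zero (pow_ne_zero _ (by norm_num)) (by positivity) hc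
    refine ⟨Polynomial.reflect n (freeBrownianMoment n), ?_, ?_, fun t ht => ?_⟩
    · rw [Polynomial.degree_eq_natDegree hne, hdeg]
    · rw [Polynomial.leadingCoeff, hdeg, hc]
    · let _ : Invertible t := invertibleOfNonzero ht.ne'
      let _ : Invertible t⁻¹ := invertibleOfNonzero (inv_ne_zero ht.ne')
      have h := Polynomial.eval₂_reflect_mul_pow (RingHom.id ℝ) t⁻¹ n (freeBrownianMoment n)
        (natDegree_freeBrownianMoment_le n)
      rw [invOf_eq_inv, inv_inv, Polynomial.eval₂_id, Polynomial.eval₂_id] at h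
      rw [hm t ht, ← h, inv_pow]
      field_simp
  · intro t ht
    have hd : HasDerivAt (fun s : ℝ => s ^ n * (freeBrownianMoment n).eval s⁻¹)
        (n * t ^ (n - 1) * (freeBrownianMoment n).eval t⁻¹ +
          t ^ n * ((freeBrownianMoment n).derivative.eval t⁻¹ * -(t ^ 2)⁻¹)) t :=
      (hasDerivAt_pow n t).mul
        (((freeBrownianMoment n).hasDerivAt t⁻¹).comp t (hasDerivAt_inv ht.ne'))
    have hd' := hd.congr_of_eventuallyEq (f₁ := fun s : ℝ => moment (ρ s) n)
      (Filter.eventually_of_mem (Ioi_mem_nhds ht) fun s hs => hm s hs n)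
    convert! hd' using 1
    have hq := congrArg (Polynomial.eval t⁻¹) (two_mul_derivative_freeBrownianMoment n)
    simp only [Polynomial.eval_mul, Polynomial.eval_natCast, Polynomial.eval_finsetSum,
      Polynomial.eval_ofNat] at hq
    have hsum : ∑ j ∈ Finset.range (n - 1), moment (ρ t) j * moment (ρ t) (n - j - 2) =
        t ^ n * (t ^ 2)⁻¹ * ∑ j ∈ Finset.range (n - 1), (freeBrownianMoment j).eval t⁻¹ *
          (freeBrownianMoment (n - j - 2)).eval t⁻¹ := by
      rw [Finset.mul_sum]
      refine Finset.sum_congr rfl fun j hj => ?_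
      have hj := Finset.mem_range.1 hj
      rw [hm t ht, hm t ht]
      have hn : t ^ n = t ^ j * t ^ (n - j - 2) * t ^ 2 := by
        rw [← pow_add, ← pow_add]
        congr 1
        omega
      rw [hn]
      field_simp
    have hpow : (n : ℝ) * (t⁻¹ * t ^ n) = n * t ^ (n - 1) := by
      cases n with
      | zero => simp
      | succ n =>
        rw [Nat.add_sub_cancel, pow_succ]
        field_simp
    rw [hsum, hm t ht]
    linear_combination (freeBrownianMoment n).eval t⁻¹ * hpow + t ^ n * (t ^ 2)⁻¹ / 2 * hq
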